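/- If ⟨ψ_k, (B ⊗ I_n) ψ_l⟩ = 0 for all k, l with 1 ≤ k, l ≤ 2p−1 and k ≠ l, then the top-left p×p block of B is a scalar multiple of the identity: B_{ab} = B_{00}·δ_{ab} for all 0 ≤ a, b ≤ p−1. -/

import Mathlib

open scoped ComplexInnerProductSpace Kronecker ComplexOrder

/-- The `i`-th standard basis vector `|i⟩` of `ℂ^m` (zero if `i ≥ m`). -/
noncomputable def ket (m i : ℕ) : EuclideanSpace ℂ (Fin m) :=
  (WithLp.equiv 2 (Fin m → ℂ)).symm fun a => if (a : ℕ) = i then 1 else 0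

/-- The product state `v ⊗ w`, with entries `(v ⊗ w)_{(a,b)} = v_a * w_b`. -/
noncomputable def tp {m n : ℕ} (v : EuclideanSpace ℂ (Fin m)) (w : EuclideanSpace ℂ (Fin n)) :
    EuclideanSpace ℂ (Fin m × Fin n) :=
  (WithLp.equiv 2 (Fin m × Fin n → ℂ)).symm fun ab => v ab.1 * w ab.2

/-- The scalar `1/√2`. -/
noncomputable def invSqrt2 : ℂ := ((Real.sqrt 2)⁻¹ : ℝ)

/-- A matrix on `ℂ^m ⊗ ℂ^n` acting as a linear map. -/
noncomputable def act {m n : ℕ} (M : Matrix (Fin m × Fin n) (Fin m × Fin n) ℂ)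
    (x : EuclideanSpace ℂ (Fin m × Fin n)) : EuclideanSpace ℂ (Fin m × Fin n) :=
  Matrix.toEuclideanLin M x

/-- The index `j(i)`: `j(i) = i + 1` for `i ≤ p - 2`, and `j(p-1) = 1`. -/
def jf (p i : ℕ) : ℕ := if i = p - 1 then 1 else i + 1

/-- The unnormalized uniform superposition `|0⟩ + |1⟩ + ⋯ + |p-1⟩` in `ℂ^m`. -/
noncomputable def unif (m p : ℕ) : EuclideanSpace ℂ (Fin m) :=
  ∑ i ∈ Finset.range p, ket m i

/-- The `2p-1` product states `ψ_k` (`1 ≤ k ≤ 2p-1`) of Theorem 2: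
`ψ_i = |i⟩ ⊗ (|0⟩-|i⟩)/√2`, `ψ_{i+p-1} = (|0⟩-|i⟩)/√2 ⊗ |j(i)⟩` for `1 ≤ i ≤ p-1`,
and `ψ_{2p-1} = (1/p)(|0⟩+⋯+|p-1⟩) ⊗ (|0⟩+⋯+|p-1⟩)`. -/
noncomputable def psi2 (m n p k : ℕ) : EuclideanSpace ℂ (Fin m × Fin n) :=
  if k ≤ p - 1 then tp (ket m k) (invSqrt2 • (ket n 0 - ket n k))
  else if k ≤ 2 * p - 2 then
    tp (invSqrt2 • (ket m 0 - ket m (k - (p - 1)))) (ket n (jf p (k - (p - 1))))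
  else ((p : ℂ))⁻¹ • tp (unif m p) (unif n p)

theorem inner_tp_act_kronecker_one {m n : ℕ} (B : Matrix (Fin m) (Fin m) ℂ)
    (v v' : EuclideanSpace ℂ (Fin m)) (w w' : EuclideanSpace ℂ (Fin n)) :
    ⟪tp v w, act (B ⊗ₖ (1 : Matrix (Fin n) (Fin n) ℂ)) (tp v' w')⟫ =
      ⟪v, Matrix.toEuclideanLin B v'⟫ * ⟪w, w'⟫ := by
  simp only [act, tp, PiLp.inner_apply, RCLike.inner_apply, Matrix.toLpLin_apply,
    WithLp.equiv_symm_apply, Matrix.mulVec, dotProduct, Matrix.kroneckerMap_apply,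
    Matrix.one_apply, Fintype.sum_prod_type, map_mul, mul_ite, ite_mul, mul_one, mul_zero,
    zero_mul, Finset.sum_ite_eq, Finset.mem_univ, if_true, Finset.sum_mul_sum]
  refine Finset.sum_congr rfl fun a _ => Finset.sum_congr rfl fun b _ => ?_
  simp only [Finset.sum_mul]
  exact Finset.sum_congr rfl fun c _ => by ring

theorem ket_val {m : ℕ} (a : Fin m) : ket m a = EuclideanSpace.single a (1 : ℂ) := by
  ext c
  simp [ket, Fin.ext_iff]

theorem inner_ket_ket {n i k : ℕ} (hi : i < n) :
    ⟪ket n i, ket n k⟫ = if i = k then (1 : ℂ) else 0 := by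
  rw [show ket n i = EuclideanSpace.single (⟨i, hi⟩ : Fin n) (1 : ℂ) from ket_val ⟨i, hi⟩]
  simp [EuclideanSpace.inner_single_left, ket]

theorem inner_ket_toEuclideanLin_ket {m : ℕ} (B : Matrix (Fin m) (Fin m) ℂ) (a b : Fin m) :
    ⟪ket m a, Matrix.toEuclideanLin B (ket m b)⟫ = B a b := by
  simp [EuclideanSpace.inner_single_left, ket_val, Matrix.toLpLin_apply]

theorem inner_ket_unif {n p i : ℕ} (hi : i < p) (hp : p ≤ n) :
    ⟪ket n i, unif n p⟫ = (1 : ℂ) := by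
  simp [unif, inner_ket_ket (hi.trans_le hp), hi]

theorem invSqrt2_ne_zero : invSqrt2 ≠ 0 := by
  simp [invSqrt2]

theorem jf_bounds {p i : ℕ} (hp : 3 ≤ p) (h1 : 1 ≤ i) (hi : i ≤ p - 1) :
    1 ≤ jf p i ∧ jf p i ≤ p - 1 ∧ jf p i ≠ i := by
  unfold jf
  split_ifs <;> omega

theorem exists_jf_eq {p i : ℕ} (h1 : 1 ≤ i) (hi : i ≤ p - 1) :
    ∃ k, 1 ≤ k ∧ k ≤ p - 1 ∧ jf p k = i := by
  by_cases h : i = 1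
  · exact ⟨p - 1, by omega, le_rfl, by simp [jf, h]⟩
  · exact ⟨i - 1, by omega, by omega, by unfold jf; split_ifs <;> omega⟩

theorem psi2_of_le {m n p k : ℕ} (hk : k ≤ p - 1) :
    psi2 m n p k = tp (ket m k) (invSqrt2 • (ket n 0 - ket n k)) := by
  simp [psi2, hk]

theorem psi2_add {m n p k : ℕ} (h1 : 1 ≤ k) (hk : k ≤ p - 1) :
    psi2 m n p (k + (p - 1)) = tp (invSqrt2 • (ket m 0 - ket m k)) (ket n (jf p k)) := by
  rw [psi2, if_neg (by omega), if_pos (by omega), Nat.add_sub_cancel]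

theorem psi2_last {m n p : ℕ} (hp : 2 ≤ p) :
    psi2 m n p (2 * p - 1) = (p : ℂ)⁻¹ • tp (unif m p) (unif n p) := by
  rw [psi2, if_neg (by omega), if_neg (by omega)]

theorem top_left_block_scalar_small_basis (p m n : ℕ) (h3 : 3 ≤ p) (hpm : p ≤ m) (hmn : m ≤ n)
    (B : Matrix (Fin m) (Fin m) ℂ) (hB : B.PosSemidef)
    (h : ∀ k l : ℕ, 1 ≤ k → k ≤ 2 * p - 1 → 1 ≤ l → l ≤ 2 * p - 1 → k ≠ l →
      ⟪psi2 m n p k, act (B ⊗ₖ (1 : Matrix (Fin n) (Fin n) ℂ)) (psi2 m n p l)⟫ = 0) :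
    ∀ a b : Fin m, (a : ℕ) ≤ p - 1 → (b : ℕ) ≤ p - 1 →
      B a b = if (a : ℕ) = (b : ℕ)
        then B (⟨0, by omega⟩ : Fin m) (⟨0, by omega⟩ : Fin m) else 0 := by
  set A : ℕ → ℕ → ℂ := fun i k => ⟪ket m i, Matrix.toEuclideanLin B (ket m k)⟫ with hA
  have entry (a b : Fin m) : A a b = B a b := inner_ket_toEuclideanLin_ket B a b
  have hs := invSqrt2_ne_zero
  have off_diag {i k : ℕ} (hi : 1 ≤ i) (hi' : i ≤ p - 1) (hk : 1 ≤ k) (hk' : k ≤ p - 1)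
      (hik : i ≠ k) : A i k = 0 := by
    have := h i k hi (by omega) hk (by omega) hik
    rw [psi2_of_le hi', psi2_of_le hk', inner_tp_act_kronecker_one] at this
    simpa [-inner_self_eq_norm_sq_to_K, hA, inner_smul_left, inner_smul_right, inner_sub_left, inner_sub_right,
      inner_ket_ket (show 0 < n by omega), inner_ket_ket (show i < n by omega), hs, hik,
      show i ≠ 0 by omega, show 0 ≠ k by omega] using this
  have col_zero {i : ℕ} (hi : 1 ≤ i) (hi' : i ≤ p - 1) : A i 0 = 0 := by
    obtain ⟨k, hk, hk', rfl⟩ := exists_jf_eq hi hi'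
    have := h (jf p k) (k + (p - 1)) hi (by omega) (by omega) (by omega) (by omega)
    rw [psi2_of_le hi', psi2_add hk hk', inner_tp_act_kronecker_one] at this
    have hz := off_diag hi hi' hk hk' (jf_bounds h3 hk hk').2.2
    simp only [hA] at hz
    simpa [-inner_self_eq_norm_sq_to_K, hA, inner_smul_left, inner_smul_right, inner_sub_left, inner_sub_right,
      inner_ket_ket (show 0 < n by omega), inner_ket_ket (show jf p k < n by omega), hs, hz,
      show 0 ≠ jf p k by omega] using this
  have row_zero {i : ℕ} (hi : 1 ≤ i) (hi' : i ≤ p - 1) : A 0 i = 0 := by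
    have hc := col_zero hi hi'
    have e₁ := entry ⟨i, by omega⟩ ⟨0, by omega⟩
    have e₂ := entry ⟨0, by omega⟩ ⟨i, by omega⟩
    simp only at e₁ e₂
    rw [e₂, ← hB.isHermitian.apply, ← e₁, hc, star_zero]
  have ne_zero {i k : ℕ} (hi : i ≤ p - 1) (hk : k ≤ p - 1) (hik : i ≠ k) : A i k = 0 := by
    rcases Nat.eq_zero_or_pos i with rfl | hi₀
    · exact row_zero (by omega) hk
    rcases Nat.eq_zero_or_pos k with rfl | hk₀
    · exact col_zero hi₀ hi
    exact off_diag hi₀ hi hk₀ hk hik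
  have inner_unif {i : ℕ} (hi : i ≤ p - 1) :
      ⟪ket m i, Matrix.toEuclideanLin B (unif m p)⟫ = A i i := by
    rw [unif, map_sum, inner_sum]
    refine Finset.sum_eq_single_of_mem i (Finset.mem_range.2 (by omega)) fun k hk hki => ?_
    exact ne_zero hi (by have := Finset.mem_range.1 hk; omega) hki.symm
  have diag {i : ℕ} (hi : i ≤ p - 1) : A i i = A 0 0 := by
    rcases Nat.eq_zero_or_pos i with rfl | hi₀
    · rfl
    have := h (i + (p - 1)) (2 * p - 1) (by omega) (by omega) (by omega) (by omega) (by omega)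
    have hj := jf_bounds h3 hi₀ hi
    rw [psi2_add hi₀ hi, psi2_last (by omega), act, map_smul, ← act, inner_smul_right,
      inner_tp_act_kronecker_one, inner_ket_unif (by omega) (by omega), inner_smul_left,
      inner_sub_left, inner_unif hi, inner_unif (Nat.zero_le _)] at this
    have hp : (p : ℂ) ≠ 0 := by norm_cast; omega
    simp only [mul_one, mul_eq_zero, inv_eq_zero, hp, map_eq_zero, hs, false_or] at this
    exact (sub_eq_zero.1 this).symm
  intro a b ha hb
  rw [← entry a b, ← entry ⟨0, by omega⟩ ⟨0, by omega⟩]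
  split_ifs with hab
  · rw [← hab]
    exact diag ha
  · exact ne_zero ha hb hab
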